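/- arXiv:2510.11102 — 4 statements merged into one kernel-verified Lean document; each statement's English description precedes it below -/
import Mathlib

section
/- If G and H are c-utility act sets on K, then the Minkowski sum G + H is closed; consequently G + H is again a c-utility act set, and h_{G+H}(p) = h_G(p) + h_H(p) for every p ∈ Δ(K). -/
open MeasureTheory Pointwise

/-- The pairing `⟨p, x⟩ = ∑ k, p k * x k`. -/
def pairing {K : Type} [Fintype K] (p x : K → ℝ) : ℝ := ∑ k, p k * x k

/-- The simplex of beliefs `Δ(K)`. -/
def simplexSet (K : Type) [Fintype K] : Set (K → ℝ) :=
  {p | (∀ k, 0 ≤ p k) ∧ ∑ k, p k = 1}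

/-- The negative orthant `ℝ₋^K`. -/
def negOrthant (K : Type) [Fintype K] : Set (K → ℝ) := {v | ∀ k, v k ≤ 0}

/-- The restricted support function `h_G`. -/
noncomputable def suppFn {K : Type} [Fintype K] (G : Set (K → ℝ)) (p : K → ℝ) : ℝ :=
  sSup ((fun g => pairing p g) '' G)

/-- A c-utility act set: nonempty, closed, convex, comprehensive, with
`{⟨p, g⟩ : g ∈ G}` bounded above for each belief `p`, and `h_G` continuous on the simplex. -/
def IsCUAS {K : Type} [Fintype K] (G : Set (K → ℝ)) : Prop :=
  G.Nonempty ∧ IsClosed G ∧ Convex ℝ G ∧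
  (∀ g ∈ G, ∀ v ∈ negOrthant K, g + v ∈ G) ∧
  (∀ p ∈ simplexSet K, BddAbove ((fun g => pairing p g) '' G)) ∧
  ContinuousOn (suppFn G) (simplexSet K)

/-- The value of information of information structure `q` for decision maker `G`. -/
noncomputable def VoI {K : Type} [Fintype K] (G : Set (K → ℝ)) {Ω : Type}
    [MeasurableSpace Ω] (ℙ : Measure Ω) (q : Ω → K → ℝ) : ℝ :=
  (∫ ω, suppFn G (q ω) ∂ℙ) - suppFn G (∫ ω, q ω ∂ℙ)

lemma pairing_add {K : Type} [Fintype K] (p x y : K → ℝ) :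
    pairing p (x + y) = pairing p x + pairing p y := by
  simp [pairing, mul_add, Finset.sum_add_distrib]

lemma image_pairing_add {K : Type} [Fintype K] (p : K → ℝ) (G H : Set (K → ℝ)) :
    (fun x => pairing p x) '' (G + H) =
      (fun x => pairing p x) '' G + (fun x => pairing p x) '' H :=
  Set.image_image2_distrib (pairing_add p)

lemma suppFn_add {K : Type} [Fintype K] {p : K → ℝ} {G H : Set (K → ℝ)}
    (hG : G.Nonempty) (hH : H.Nonempty)
    (hbG : BddAbove ((fun x => pairing p x) '' G))
    (hbH : BddAbove ((fun x => pairing p x) '' H)) :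
    suppFn (G + H) p = suppFn G p + suppFn H p := by
  rw [suppFn, image_pairing_add, csSup_add (hG.image _) hbG (hH.image _) hbH, suppFn, suppFn]

lemma bddAbove_of_bddAbove_pairing {K : Type} [Fintype K] {G : Set (K → ℝ)}
    (h : ∀ p ∈ simplexSet K, BddAbove ((fun x => pairing p x) '' G)) : BddAbove G := by
  classical
  refine bddAbove_pi.2 fun k => ?_
  have hk : Pi.single k 1 ∈ simplexSet K :=
    ⟨fun j => (Pi.single_nonneg.2 zero_le_one : (0 : K → ℝ) ≤ Pi.single k 1) j, by simp⟩
  have hfun : (fun x : K → ℝ => pairing (Pi.single k 1) x) = Function.eval k := by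
    funext x
    simp [pairing, Pi.single_apply]
  simpa only [hfun] using h _ hk

/-- The sum of two closed subsets of `ℝ^K` that are bounded above is closed. -/
lemma isClosed_add_of_bddAbove {K : Type} [Fintype K] {G H : Set (K → ℝ)}
    (hG : IsClosed G) (hH : IsClosed H) (hbG : BddAbove G) (hbH : BddAbove H) :
    IsClosed (G + H) := by
  obtain ⟨a, ha⟩ := hbG
  obtain ⟨b, hb⟩ := hbH
  refine isClosed_of_closure_subset fun x hx => ?_
  let U : Set (K → ℝ) := Set.univ.pi fun k => Set.Ioi (x k - 1)
  have hU : IsOpen U := isOpen_set_pi Set.finite_univ fun _ _ => isOpen_Ioi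
  have hxU : x ∈ U := fun k _ => sub_one_lt (x k)
  have hcompact : IsCompact (G ∩ Set.Icc (x - 1 - b) a) := isCompact_Icc.inter_left hG
  have hsub : U ∩ (G + H) ⊆ G ∩ Set.Icc (x - 1 - b) a + H := by
    rintro _ ⟨hyU, g, hg, h, hh, rfl⟩
    refine Set.add_mem_add ⟨hg, fun k => ?_, ha hg⟩ hh
    have h₁ : x k - 1 < g k + h k := hyU k trivial
    have h₂ : h k ≤ b k := hb hh k
    change x k - 1 - b k ≤ g k
    linarith
  exact Set.add_subset_add_right Set.inter_subset_left <|
    closure_minimal hsub (hH.add_left_of_isCompact hcompact) (hU.inter_closure ⟨hxU, hx⟩)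

theorem minkowski_sum_of_CUAS_is_CUAS
    {K : Type} [Fintype K] [Nonempty K] (G H : Set (K → ℝ))
    (hG : IsCUAS G) (hH : IsCUAS H) :
    IsClosed (G + H) ∧ IsCUAS (G + H) ∧
      ∀ p ∈ simplexSet K, suppFn (G + H) p = suppFn G p + suppFn H p := by
  obtain ⟨hneG, hclG, hcvG, -, hbG, hcG⟩ := hG
  obtain ⟨hneH, hclH, hcvH, hcompH, hbH, hcH⟩ := hH
  have hcl : IsClosed (G + H) := isClosed_add_of_bddAbove hclG hclH
    (bddAbove_of_bddAbove_pairing hbG) (bddAbove_of_bddAbove_pairing hbH)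
  have hsupp : ∀ p ∈ simplexSet K, suppFn (G + H) p = suppFn G p + suppFn H p :=
    fun p hp => suppFn_add hneG hneH (hbG p hp) (hbH p hp)
  refine ⟨hcl, ⟨hneG.add hneH, hcl, hcvG.add hcvH, ?_, fun p hp => ?_,
    (hcG.add hcH).congr hsupp⟩, hsupp⟩
  · rintro _ ⟨g, hg, h, hh, rfl⟩ v hv
    exact ⟨g, hg, h + v, hcompH h hh v hv, (add_assoc g h v).symm⟩
  · rw [image_pairing_add]
    exact (hbG p hp).add (hbH p hp)
end

section
/- Let f : ℝ^K → ℝ be convex on Δ(K) and lower semicontinuous on Δ(K), and define Θf = {x ∈ ℝ^K : ∀ p ∈ Δ(K), ⟨p, x⟩ ≤ f(p)}. Then: (a) for every y ∈ ℝ^K with y k ≥ 0 for all k and y ≠ 0, the set {⟨y, x⟩ : x ∈ Θf} is bounded above and sSup {⟨y, x⟩ : x ∈ Θf} = (∑_k y k) * f((∑_k y k)⁻¹ • y); (b) for every y ∈ ℝ^K with y k < 0 for some k, the set {⟨y, x⟩ : x ∈ Θf} is not bounded above. That is, the support function of Θf is the positively homogeneous extension of f, with effective domain contained in the nonnegative orthant.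 -/
open MeasureTheory Pointwise

/-- The set `Θf` cut out below a function `f` of beliefs. -/
def thetaSet {K : Type} [Fintype K] (f : (K → ℝ) → ℝ) : Set (K → ℝ) :=
  {x | ∀ p ∈ simplexSet K, pairing p x ≤ f p}

lemma isClosed_simplexSet (K : Type) [Fintype K] : IsClosed (simplexSet K) :=
  isClosed_stdSimplex ℝ K

lemma pairing_smul_left {K : Type} [Fintype K] (s : ℝ) (y x : K → ℝ) :
    pairing (s • y) x = s * pairing y x := by
  simp [pairing, Finset.mul_sum, mul_assoc]

lemma pairing_sub_single {K : Type} [Fintype K] [DecidableEq K] (y x : K → ℝ) (k : K) (t : ℝ) :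
    pairing y (x - Pi.single k t) = pairing y x - y k * t := by
  simp [pairing, mul_sub, Finset.sum_sub_distrib, Pi.single_apply]

/-- On the simplex every affine function is of the form `p ↦ ⟨p, x⟩`. -/
lemma pairing_affine_eq {K : Type} [Fintype K] [DecidableEq K] (l : (K → ℝ) →L[ℝ] ℝ) (c : ℝ)
    {p : K → ℝ} (hp : p ∈ simplexSet K) :
    pairing p (fun k => l (Pi.single k 1) + c) = l p + c := by
  have h : l p = ∑ k, p k * l (Pi.single k 1) := by
    conv_lhs => rw [pi_eq_sum_univ' p]
    simp
  simp only [pairing, mul_add, Finset.sum_add_distrib, ← Finset.sum_mul, hp.2, one_mul, h]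

lemma exists_mem_thetaSet_pairing_eq {K : Type} [Fintype K] {f : (K → ℝ) → ℝ}
    (hconv : ConvexOn ℝ (simplexSet K) f) (hlsc : LowerSemicontinuousOn f (simplexSet K))
    {p : K → ℝ} (hp : p ∈ simplexSet K) {a : ℝ} (ha : a < f p) :
    ∃ x ∈ thetaSet f, pairing p x = a := by
  classical
  obtain ⟨l, c, hle, heq⟩ :=
    hconv.exists_affine_le_of_lt (𝕜 := ℝ) hp ha (isClosed_simplexSet K) hlsc
  refine ⟨fun k => l (Pi.single k 1) + c, fun q hq => ?_, ?_⟩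
  · rw [pairing_affine_eq l c hq]
    simpa using hle ⟨q, hq⟩
  · rw [pairing_affine_eq l c hp]
    simpa using heq

lemma sub_single_mem_thetaSet {K : Type} [Fintype K] [DecidableEq K] {f : (K → ℝ) → ℝ}
    {x : K → ℝ} (hx : x ∈ thetaSet f) (k : K) {t : ℝ} (ht : 0 ≤ t) :
    x - Pi.single k t ∈ thetaSet f := fun p hp => by
  rw [pairing_sub_single]
  linarith [hx p hp, mul_nonneg (hp.1 k) ht]

theorem thetaSet_support_function_is_homogeneous_extension
    {K : Type} [Fintype K] [Nonempty K] (f : (K → ℝ) → ℝ)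
    (hconv : ConvexOn ℝ (simplexSet K) f)
    (hlsc : LowerSemicontinuousOn f (simplexSet K)) :
    (∀ y : K → ℝ, (∀ k, 0 ≤ y k) → y ≠ 0 →
      BddAbove ((fun x => pairing y x) '' thetaSet f) ∧
      sSup ((fun x => pairing y x) '' thetaSet f)
        = (∑ k, y k) * f ((∑ k, y k)⁻¹ • y)) ∧
    (∀ y : K → ℝ, (∃ k, y k < 0) →
      ¬ BddAbove ((fun x => pairing y x) '' thetaSet f)) := by
  classical
  refine ⟨fun y hy hy0 => ?_, fun y ⟨k, hk⟩ ⟨b, hb⟩ => ?_⟩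
  · set s := ∑ k, y k with hs
    have hspos : 0 < s := Fintype.sum_pos (lt_of_le_of_ne hy hy0.symm)
    have hp : s⁻¹ • y ∈ simplexSet K := by
      refine ⟨fun k => mul_nonneg (inv_nonneg.2 hspos.le) (hy k), ?_⟩
      simp only [Pi.smul_apply, smul_eq_mul, ← Finset.mul_sum, ← hs]
      exact inv_mul_cancel₀ hspos.ne'
    have hpair (x : K → ℝ) : pairing y x = s * pairing (s⁻¹ • y) x := by
      rw [← pairing_smul_left, smul_inv_smul₀ hspos.ne']
    have hle : ∀ r ∈ (fun x => pairing y x) '' thetaSet f, r ≤ s * f (s⁻¹ • y) := by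
      rintro _ ⟨x, hx, rfl⟩
      simp only [hpair x]
      exact mul_le_mul_of_nonneg_left (hx _ hp) hspos.le
    refine ⟨⟨_, hle⟩, csSup_eq_of_forall_le_of_forall_lt_exists_gt ?_ hle fun w hw => ?_⟩
    · obtain ⟨x, hx, -⟩ := exists_mem_thetaSet_pairing_eq hconv hlsc hp (sub_one_lt _)
      exact ⟨_, x, hx, rfl⟩
    · obtain ⟨a, hwa, ha⟩ := exists_between ((div_lt_iff₀' hspos).2 hw)
      obtain ⟨x, hx, hxa⟩ := exists_mem_thetaSet_pairing_eq hconv hlsc hp ha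
      refine ⟨_, ⟨x, hx, rfl⟩, ?_⟩
      simp only [hpair x, hxa]
      exact (div_lt_iff₀' hspos).1 hwa
  · obtain ⟨x, hx, -⟩ := exists_mem_thetaSet_pairing_eq hconv hlsc
      (single_mem_stdSimplex ℝ k : Pi.single k 1 ∈ simplexSet K) (sub_one_lt _)
    have hbx : pairing y x ≤ b := hb ⟨x, hx, rfl⟩
    have ht : 0 ≤ (b - pairing y x + 1) / -y k := div_nonneg (by linarith) (by linarith)
    have h : pairing y (x - Pi.single k ((b - pairing y x + 1) / -y k)) ≤ b :=
      hb ⟨_, sub_single_mem_thetaSet hx k ht, rfl⟩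
    have hmul : y k * ((b - pairing y x + 1) / -y k) = -(b - pairing y x + 1) := by
      field_simp [hk.ne]
    rw [pairing_sub_single, hmul] at h
    linarith
end

section
/- Let L and G be c-utility act sets on K and let L ⊕ G := closure(convexHull ℝ (L ∪ G)), which is again a c-utility act set with h_{L⊕G}(p) = max(h_L(p), h_G(p)) for every p ∈ Δ(K). Then L ⊕ G values information more than L (i.e., VoI_{L⊕G}(q) ≥ VoI_L(q) for every information structure q on every probability space) if and only if the function p ↦ max(0, h_G(p) − h_L(p)) is convex on Δ(K). -/
open MeasureTheory Pointwise

lemma isLinearMap_pairing {K : Type} [Fintype K] (p : K → ℝ) :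
    IsLinearMap ℝ (pairing p) where
  map_add x y := by simp [pairing, mul_add, Finset.sum_add_distrib]
  map_smul c x := by
    simp only [pairing, Pi.smul_apply, smul_eq_mul, Finset.mul_sum, mul_left_comm]

lemma continuous_pairing {K : Type} [Fintype K] (p : K → ℝ) : Continuous (pairing p) := by
  unfold pairing
  fun_prop

lemma isCompact_simplexSet (K : Type) [Fintype K] : IsCompact (simplexSet K) :=
  isCompact_stdSimplex ℝ K

lemma convex_simplexSet (K : Type) [Fintype K] : Convex ℝ (simplexSet K) :=
  convex_stdSimplex ℝ K

lemma IsCUAS.isLUB_suppFn {K : Type} [Fintype K] {G : Set (K → ℝ)} (hG : IsCUAS G)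
    {p : K → ℝ} (hp : p ∈ simplexSet K) : IsLUB (pairing p '' G) (suppFn G p) :=
  isLUB_csSup (hG.1.image _) (hG.2.2.2.2.1 p hp)

lemma IsCUAS.continuousOn_suppFn {K : Type} [Fintype K] {G : Set (K → ℝ)} (hG : IsCUAS G) :
    ContinuousOn (suppFn G) (simplexSet K) :=
  hG.2.2.2.2.2

/-- Passing to the closed convex hull does not change the least upper bound of a linear form. -/
lemma isLUB_pairing_closure_convexHull {K : Type} [Fintype K] {S : Set (K → ℝ)} {p : K → ℝ}
    {c : ℝ} (h : IsLUB (pairing p '' S) c) :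
    IsLUB (pairing p '' closure (convexHull ℝ S)) c := by
  refine ⟨?_, fun b hb => h.2 fun y hy =>
    hb (Set.image_mono ((subset_convexHull ℝ S).trans subset_closure) hy)⟩
  rintro _ ⟨x, hx, rfl⟩
  have hsub : S ⊆ {x | pairing p x ≤ c} := fun y hy => h.1 ⟨y, hy, rfl⟩
  exact closure_minimal
    (convexHull_min hsub (convex_halfSpace_le (isLinearMap_pairing p) c))
    (isClosed_le (continuous_pairing p) continuous_const) hx

lemma IsCUAS.isLUB_closure_convexHull_union {K : Type} [Fintype K] {L G : Set (K → ℝ)}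
    (hL : IsCUAS L) (hG : IsCUAS G) {p : K → ℝ} (hp : p ∈ simplexSet K) :
    IsLUB (pairing p '' closure (convexHull ℝ (L ∪ G))) (max (suppFn L p) (suppFn G p)) := by
  apply isLUB_pairing_closure_convexHull
  rw [Set.image_union]
  exact (hL.isLUB_suppFn hp).union (hG.isLUB_suppFn hp)

lemma IsCUAS.suppFn_closure_convexHull_union {K : Type} [Fintype K] {L G : Set (K → ℝ)}
    (hL : IsCUAS L) (hG : IsCUAS G) {p : K → ℝ} (hp : p ∈ simplexSet K) :
    suppFn (closure (convexHull ℝ (L ∪ G))) p = max (suppFn L p) (suppFn G p) :=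
  (hL.isLUB_closure_convexHull_union hG hp).csSup_eq
    ((hL.1.mono (Set.subset_union_left.trans
      ((subset_convexHull ℝ _).trans subset_closure))).image _)

/-- The closed convex hull of a set stable under a translation is stable under it. -/
lemma add_mem_closure_convexHull {E : Type*} [AddCommGroup E] [Module ℝ E] [TopologicalSpace E]
    [ContinuousAdd E] {S : Set E} {v : E} (h : ∀ g ∈ S, g + v ∈ S) {x : E}
    (hx : x ∈ closure (convexHull ℝ S)) : x + v ∈ closure (convexHull ℝ S) := by
  refine map_mem_closure (f := (· + v)) (by fun_prop) hx fun y hy => ?_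
  have hsub : S ⊆ (fun z => z + v) ⁻¹' convexHull ℝ S :=
    fun g hg => subset_convexHull ℝ S (h g hg)
  exact convexHull_min hsub ((convex_convexHull ℝ S).translate_preimage_left v) hy

lemma IsCUAS.closure_convexHull_union {K : Type} [Fintype K] {L G : Set (K → ℝ)}
    (hL : IsCUAS L) (hG : IsCUAS G) : IsCUAS (closure (convexHull ℝ (L ∪ G))) := by
  refine ⟨hL.1.mono (Set.subset_union_left.trans ((subset_convexHull ℝ _).trans subset_closure)),
    isClosed_closure, (convex_convexHull ℝ _).closure, fun g hg v hv => ?_,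
    fun p hp => ⟨_, (hL.isLUB_closure_convexHull_union hG hp).1⟩, ?_⟩
  · refine add_mem_closure_convexHull (fun g hg => ?_) hg
    exact hg.imp (fun h => hL.2.2.2.1 g h v hv) (fun h => hG.2.2.2.1 g h v hv)
  · exact (ContinuousOn.sup hL.continuousOn_suppFn hG.continuousOn_suppFn).congr
      fun p hp => hL.suppFn_closure_convexHull_union hG hp

lemma integrable_comp_of_continuousOn_isCompact {E Ω : Type*} [TopologicalSpace E]
    [MeasurableSpace E] [BorelSpace E] [MeasurableSpace Ω] {ℙ : Measure Ω} [IsFiniteMeasure ℙ]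
    {s : Set E} (hs : IsCompact s) {f : E → ℝ} (hf : ContinuousOn f s) {q : Ω → E}
    (hq : Measurable q) (hqs : ∀ ω, q ω ∈ s) : Integrable (fun ω => f (q ω)) ℙ := by
  obtain ⟨C, hC⟩ := hs.exists_bound_of_continuousOn hf
  have hm : Measurable fun ω => f (q ω) :=
    hf.domRestrict.measurable.comp (hq.subtype_mk (h := hqs))
  exact Integrable.of_bound hm.aestronglyMeasurable C (.of_forall fun ω => hC _ (hqs ω))

lemma integrable_of_mem_simplexSet {K Ω : Type} [Fintype K] [MeasurableSpace Ω]
    {ℙ : Measure Ω} [IsFiniteMeasure ℙ] {q : Ω → K → ℝ} (hq : Measurable q)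
    (hqs : ∀ ω, q ω ∈ simplexSet K) : Integrable q ℙ :=
  Integrable.of_eval fun k =>
    integrable_comp_of_continuousOn_isCompact (isCompact_simplexSet K)
      (continuous_apply k).continuousOn hq hqs

lemma integral_mem_simplexSet {K Ω : Type} [Fintype K] [MeasurableSpace Ω]
    {ℙ : Measure Ω} [IsProbabilityMeasure ℙ] {q : Ω → K → ℝ} (hq : Measurable q)
    (hqs : ∀ ω, q ω ∈ simplexSet K) : ∫ ω, q ω ∂ℙ ∈ simplexSet K :=
  (convex_simplexSet K).integral_mem (isCompact_simplexSet K).isClosed (.of_forall hqs)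
    (integrable_of_mem_simplexSet hq hqs)

lemma IsCUAS.VoI_closure_convexHull_union_sub {K Ω : Type} [Fintype K] [MeasurableSpace Ω]
    {ℙ : Measure Ω} [IsProbabilityMeasure ℙ] {L G : Set (K → ℝ)} (hL : IsCUAS L)
    (hG : IsCUAS G) {q : Ω → K → ℝ} (hq : Measurable q) (hqs : ∀ ω, q ω ∈ simplexSet K) :
    VoI (closure (convexHull ℝ (L ∪ G))) ℙ q - VoI L ℙ q =
      (∫ ω, max 0 (suppFn G (q ω) - suppFn L (q ω)) ∂ℙ) -
        max 0 (suppFn G (∫ ω, q ω ∂ℙ) - suppFn L (∫ ω, q ω ∂ℙ)) := by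
  have key : ∀ p ∈ simplexSet K, max 0 (suppFn G p - suppFn L p) =
      suppFn (closure (convexHull ℝ (L ∪ G))) p - suppFn L p := fun p hp => by
    rw [hL.suppFn_closure_convexHull_union hG hp, ← max_sub_sub_right, sub_self]
  have hint {S : Set (K → ℝ)} (hS : IsCUAS S) : Integrable (fun ω => suppFn S (q ω)) ℙ :=
    integrable_comp_of_continuousOn_isCompact (isCompact_simplexSet K)
      hS.continuousOn_suppFn hq hqs
  simp only [key _ (hqs _), key _ (integral_mem_simplexSet hq hqs)]
  rw [integral_sub (hint (hL.closure_convexHull_union hG)) (hint hL)]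
  simp only [VoI]
  ring

lemma integral_smul_dirac_add_smul_dirac {F : Type*} [NormedAddCommGroup F] [NormedSpace ℝ F]
    [CompleteSpace F] {a b : ℝ} (ha : 0 ≤ a) (hb : 0 ≤ b) (g : Bool → F) :
    ∫ i, g i ∂(ENNReal.ofReal a • Measure.dirac true + ENNReal.ofReal b • Measure.dirac false) =
      a • g true + b • g false := by
  rw [integral_add_measure (Integrable.of_finite.smul_measure ENNReal.ofReal_ne_top)
    (Integrable.of_finite.smul_measure ENNReal.ofReal_ne_top)]
  simp [integral_smul_measure, ENNReal.toReal_ofReal, ha, hb]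

/-- A function satisfying Jensen's inequality for all two-point distributions is convex. -/
lemma convexOn_of_map_integral_le {E : Type*} [NormedAddCommGroup E] [NormedSpace ℝ E]
    [CompleteSpace E] {s : Set E} (hs : Convex ℝ s) {f : E → ℝ}
    (h : ∀ (μ : Measure Bool), IsProbabilityMeasure μ → ∀ q : Bool → E, (∀ i, q i ∈ s) →
      f (∫ i, q i ∂μ) ≤ ∫ i, f (q i) ∂μ) : ConvexOn ℝ s f := by
  refine ⟨hs, fun x hx y hy a b ha hb hab => ?_⟩
  have hprob : IsProbabilityMeasure (ENNReal.ofReal a • Measure.dirac true +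
      ENNReal.ofReal b • Measure.dirac false : Measure Bool) := ⟨by
    simp [← ENNReal.ofReal_add ha hb, hab]⟩
  simpa [integral_smul_dirac_add_smul_dirac ha hb] using
    h _ hprob (fun i => cond i x y) (by simp [hx, hy])

theorem union_values_information_more_iff
    {K : Type} [Fintype K] [Nonempty K] (L G : Set (K → ℝ))
    (hL : IsCUAS L) (hG : IsCUAS G) :
    IsCUAS (closure (convexHull ℝ (L ∪ G))) ∧
    (∀ p ∈ simplexSet K,
      suppFn (closure (convexHull ℝ (L ∪ G))) p = max (suppFn L p) (suppFn G p)) ∧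
    ((∀ (Ω : Type) [MeasurableSpace Ω] (ℙ : Measure Ω), IsProbabilityMeasure ℙ →
        ∀ q : Ω → K → ℝ, Measurable q → (∀ ω, q ω ∈ simplexSet K) →
          VoI L ℙ q ≤ VoI (closure (convexHull ℝ (L ∪ G))) ℙ q)
      ↔ ConvexOn ℝ (simplexSet K) (fun p => max 0 (suppFn G p - suppFn L p))) := by
  refine ⟨hL.closure_convexHull_union hG,
    fun p hp => hL.suppFn_closure_convexHull_union hG hp, fun h => ?_, fun h => ?_⟩
  · refine convexOn_of_map_integral_le (convex_simplexSet K) fun μ hμ q hqs => ?_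
    have hq : Measurable q := measurable_of_finite q
    rw [← sub_nonneg, ← hL.VoI_closure_convexHull_union_sub hG hq hqs, sub_nonneg]
    exact h Bool μ hμ q hq hqs
  · intro Ω _ ℙ _ q hq hqs
    have hf : ContinuousOn (fun p => max 0 (suppFn G p - suppFn L p)) (simplexSet K) :=
      continuousOn_const.sup (hG.continuousOn_suppFn.sub hL.continuousOn_suppFn)
    rw [← sub_nonneg, hL.VoI_closure_convexHull_union_sub hG hq hqs, sub_nonneg]
    exact h.map_integral_le hf (isCompact_simplexSet K).isClosed (.of_forall hqs)
      (integrable_of_mem_simplexSet hq hqs)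
      (integrable_comp_of_continuousOn_isCompact (isCompact_simplexSet K) hf hq hqs)
end

section
/- Let L and G be c-utility act sets on K and suppose there exists l ∈ L such that {p ∈ Δ(K) : ⟨p, l⟩ ≤ h_G(p)} ⊆ {p ∈ Δ(K) : h_L(p) ≤ h_G(p)} ⊆ {p ∈ Δ(K) : h_L(p) = ⟨p, l⟩}. Then: (a) for every p ∈ Δ(K), max(0, h_G(p) − h_L(p)) = max(0, h_G(p) − ⟨p, l⟩), and this function of p is convex on Δ(K); (b) closure(convexHull ℝ (L ∪ G)) = L + closure(convexHull ℝ (ℝ₋^K ∪ {g − l : g ∈ G})) (Minkowski sum). -/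
open MeasureTheory Pointwise

theorem pairing_eq_dotProduct {K : Type} [Fintype K] (p x : K → ℝ) : pairing p x = p ⬝ᵥ x := rfl

theorem pairing_single {K : Type} [Fintype K] [DecidableEq K] (k : K) (x : K → ℝ) :
    pairing (Pi.single k 1) x = x k := by
  simp [pairing_eq_dotProduct]

theorem single_mem_simplexSet {K : Type} [Fintype K] [DecidableEq K] (k : K) :
    (Pi.single k 1 : K → ℝ) ∈ simplexSet K :=
  single_mem_stdSimplex ℝ k

theorem IsCUAS.pairing_le_suppFn {K : Type} [Fintype K] {G : Set (K → ℝ)} (hG : IsCUAS G)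
    {p : K → ℝ} (hp : p ∈ simplexSet K) {g : K → ℝ} (hg : g ∈ G) :
    pairing p g ≤ suppFn G p :=
  le_csSup (hG.2.2.2.2.1 p hp) ⟨g, hg, rfl⟩

theorem suppFn_le {K : Type} [Fintype K] {G : Set (K → ℝ)} (hG : G.Nonempty)
    {p : K → ℝ} {u : ℝ} (h : ∀ g ∈ G, pairing p g ≤ u) : suppFn G p ≤ u :=
  csSup_le (hG.image _) (by rintro _ ⟨g, hg, rfl⟩; exact h g hg)

theorem IsCUAS.bddAbove {K : Type} [Fintype K] {G : Set (K → ℝ)} (hG : IsCUAS G) :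
    BddAbove G := by
  classical
  refine ⟨fun k => suppFn G (Pi.single k 1), fun g hg k => ?_⟩
  simpa only [pairing_single] using hG.pairing_le_suppFn (single_mem_simplexSet k) hg

theorem IsCUAS.convexOn_suppFn {K : Type} [Fintype K] {G : Set (K → ℝ)} (hG : IsCUAS G) :
    ConvexOn ℝ (simplexSet K) (suppFn G) := by
  refine ⟨convex_stdSimplex ℝ K, fun p hp q hq a b ha hb _ => suppFn_le hG.1 fun g hg => ?_⟩
  have hpg := mul_le_mul_of_nonneg_left (hG.pairing_le_suppFn hp hg) ha
  have hqg := mul_le_mul_of_nonneg_left (hG.pairing_le_suppFn hq hg) hb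
  simp only [pairing_eq_dotProduct, add_dotProduct, smul_dotProduct, smul_eq_mul] at *
  linarith

theorem convex_setOf_pairing_le {K : Type} [Fintype K] (p : K → ℝ) (u : ℝ) :
    Convex ℝ {x | pairing p x ≤ u} :=
  convex_halfSpace_le
    ⟨fun x y => dotProduct_add p x y, fun c x => dotProduct_smul c p x⟩ u

theorem isClosed_setOf_pairing_le {K : Type} [Fintype K] (p : K → ℝ) (u : ℝ) :
    IsClosed {x | pairing p x ≤ u} := by
  unfold pairing
  exact isClosed_le (by fun_prop) continuous_const

/-- The sum of two closed subsets of `ℝ^K` that are bounded above coordinatewise is closed. -/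
theorem isClosed_add_of_bddAbove_s17 {K : Type} [Fintype K] {A B : Set (K → ℝ)} (hA : IsClosed A)
    (hB : IsClosed B) (hA' : BddAbove A) (hB' : BddAbove B) : IsClosed (A + B) := by
  obtain ⟨a, ha⟩ := hA'
  obtain ⟨b, hb⟩ := hB'
  refine isClosed_of_closure_subset fun x hx => ?_
  have hcl : IsClosed (A ∩ Set.Icc (x - 1 - b) a + B) :=
    IsClosed.add_left_of_isCompact hB (isCompact_Icc.inter_left hA)
  have hnear : ∀ᶠ y in nhds x, x - 1 ≤ y := by
    simp only [Pi.le_def, Filter.eventually_all]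
    exact fun k => (continuous_apply k).continuousAt.eventually_const_le (by simp)
  have hmem : x ∈ A ∩ Set.Icc (x - 1 - b) a + B := by
    rw [← hcl.closure_eq, mem_closure_iff_frequently]
    refine ((mem_closure_iff_frequently.1 hx).and_eventually hnear).mono ?_
    rintro _ ⟨⟨y, hy, z, hz, rfl⟩, hxy⟩
    refine ⟨y, ⟨hy, fun k => ?_, ha hy⟩, z, hz, rfl⟩
    have hk := hxy k
    have hzk := hb hz k
    simp only [Pi.sub_apply, Pi.add_apply, Pi.one_apply] at *
    linarith
  exact Set.add_subset_add_right Set.inter_subset_left hmem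

/-- A point outside a closed convex set that contains a nonempty comprehensive set is strictly
separated from it by a belief. -/
theorem exists_simplexSet_separating {K : Type} [Fintype K] {L C : Set (K → ℝ)}
    (hL : L.Nonempty) (hcomp : ∀ g ∈ L, ∀ v ∈ negOrthant K, g + v ∈ L) (hLC : L ⊆ C)
    (hC : Convex ℝ C) (hC' : IsClosed C) {x : K → ℝ} (hx : x ∉ C) :
    ∃ p ∈ simplexSet K, ∃ u, (∀ c ∈ C, pairing p c ≤ u) ∧ u < pairing p x := by
  classical
  obtain ⟨f, u, hfC, hfx⟩ := geometric_hahn_banach_closed_point hC hC' hx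
  obtain ⟨a, ha⟩ := hL
  set w : K → ℝ := fun k => f (Pi.single k 1) with hw
  have hf : ∀ y, f y = pairing w y := fun y => by
    conv_lhs => rw [pi_eq_sum_univ' y, map_sum]
    refine Finset.sum_congr rfl fun k _ => ?_
    simp [hw, mul_comm]
  have hw0 : ∀ k, 0 ≤ w k := fun k => by
    by_contra! hk
    have hua : 0 < u - f a := sub_pos.2 (hfC a (hLC ha))
    have hneg : (((u - f a) / w k) • Pi.single k 1 : K → ℝ) ∈ negOrthant K := fun j => by
      have := (div_neg_of_pos_of_neg hua hk).le
      by_cases hj : j = k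
      · subst hj; simpa using this
      · simp [hj]
    have := hfC _ (hLC (hcomp a ha _ hneg))
    rw [map_add, map_smul, smul_eq_mul, ← show w k = f (Pi.single k 1) from rfl,
      div_mul_cancel₀ _ hk.ne] at this
    linarith
  have hsum : 0 < ∑ k, w k := by
    refine (Finset.sum_nonneg fun k _ => hw0 k).lt_of_ne' fun h0 => ?_
    have hwz : w = 0 :=
      funext fun k => (Finset.sum_eq_zero_iff_of_nonneg fun k _ => hw0 k).1 h0 k (Finset.mem_univ k)
    have h1 := hfC a (hLC ha)
    rw [hf, hwz] at h1 hfx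
    simp only [pairing, Pi.zero_apply, zero_mul, Finset.sum_const_zero] at h1 hfx
    linarith
  have hscale : ∀ y, pairing ((∑ k, w k)⁻¹ • w) y = (∑ k, w k)⁻¹ * f y := fun y => by
    rw [hf, pairing_eq_dotProduct, smul_dotProduct, smul_eq_mul, pairing_eq_dotProduct]
  refine ⟨(∑ k, w k)⁻¹ • w, ⟨fun k => mul_nonneg (inv_nonneg.2 hsum.le) (hw0 k), ?_⟩,
    (∑ k, w k)⁻¹ * u, fun c hc => ?_, ?_⟩
  · simp only [Pi.smul_apply, smul_eq_mul, ← Finset.mul_sum]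
    exact inv_mul_cancel₀ hsum.ne'
  · rw [hscale]
    exact mul_le_mul_of_nonneg_left (hfC c hc).le (inv_nonneg.2 hsum.le)
  · rw [hscale]
    exact mul_lt_mul_of_pos_left hfx (inv_pos.2 hsum)

theorem union_values_information_more_sufficient_condition
    {K : Type} [Fintype K] [Nonempty K] (L G : Set (K → ℝ))
    (hL : IsCUAS L) (hG : IsCUAS G) (l : K → ℝ) (hl : l ∈ L)
    (h1 : {p ∈ simplexSet K | pairing p l ≤ suppFn G p}
        ⊆ {p ∈ simplexSet K | suppFn L p ≤ suppFn G p})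
    (h2 : {p ∈ simplexSet K | suppFn L p ≤ suppFn G p}
        ⊆ {p ∈ simplexSet K | suppFn L p = pairing p l}) :
    (∀ p ∈ simplexSet K,
      max 0 (suppFn G p - suppFn L p) = max 0 (suppFn G p - pairing p l)) ∧
    ConvexOn ℝ (simplexSet K) (fun p => max 0 (suppFn G p - suppFn L p)) ∧
    closure (convexHull ℝ (L ∪ G))
      = L + closure (convexHull ℝ (negOrthant K ∪ ((fun g => g - l) '' G))) := by
  have hmax : ∀ p ∈ simplexSet K,
      max 0 (suppFn G p - suppFn L p) = max 0 (suppFn G p - pairing p l) := fun p hp => by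
    rcases le_or_gt (pairing p l) (suppFn G p) with h | h
    · rw [(h2 (h1 ⟨hp, h⟩)).2]
    · have := hL.pairing_le_suppFn hp hl
      rw [max_eq_left (by linarith), max_eq_left (by linarith)]
  refine ⟨hmax, ?_, ?_⟩
  · have hlin : ConcaveOn ℝ (simplexSet K) (fun p => pairing p l) :=
      ⟨convex_stdSimplex ℝ K, fun p _ q _ a b _ _ _ => by
        simp [pairing_eq_dotProduct, add_dotProduct, smul_dotProduct]⟩
    refine ((convexOn_const 0 (convex_stdSimplex ℝ K)).sup
      (hG.convexOn_suppFn.sub hlin)).congr fun p hp => ?_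
    exact (hmax p hp).symm
  set D := closure (convexHull ℝ (negOrthant K ∪ ((fun g => g - l) '' G))) with hD
  have hDconv : Convex ℝ D := (convex_convexHull ℝ _).closure
  have hsub : negOrthant K ∪ ((fun g => g - l) '' G) ⊆ D :=
    (subset_convexHull ℝ _).trans subset_closure
  apply Set.Subset.antisymm
  · have hDbdd : BddAbove D := by
      obtain ⟨b, hb⟩ := hG.bddAbove
      refine ⟨0 ⊔ (b - l), closure_minimal (convexHull_min ?_ (convex_Iic _)) isClosed_Iic⟩
      rintro _ (hv | ⟨g, hg, rfl⟩)
      · exact le_sup_of_le_left (show _ ≤ (0 : K → ℝ) from hv)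
      · exact le_sup_of_le_right (sub_le_sub_right (hb hg) l)
    refine closure_minimal (convexHull_min ?_ (hL.2.2.1.add hDconv))
      (isClosed_add_of_bddAbove_s17 hL.2.1 isClosed_closure hL.bddAbove hDbdd)
    rintro g (hg | hg)
    · exact ⟨g, hg, 0, hsub (.inl fun _ => le_rfl), add_zero g⟩
    · exact ⟨l, hl, g - l, hsub (.inr ⟨g, hg, rfl⟩), add_sub_cancel l g⟩
  · rintro _ ⟨a, ha, d, hd, rfl⟩
    by_contra hx
    have hLG : L ∪ G ⊆ closure (convexHull ℝ (L ∪ G)) :=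
      (subset_convexHull ℝ _).trans subset_closure
    obtain ⟨p, hp, u, hu, hux⟩ := exists_simplexSet_separating hL.1 hL.2.2.2.1
      (Set.subset_union_left.trans hLG) (convex_convexHull ℝ _).closure isClosed_closure hx
    have huL : suppFn L p ≤ u := suppFn_le hL.1 fun g hg => hu g (hLG (.inl hg))
    have huG : suppFn G p ≤ u := suppFn_le hG.1 fun g hg => hu g (hLG (.inr hg))
    have hdp : pairing p d ≤ max 0 (suppFn G p - pairing p l) := by
      refine closure_minimal (convexHull_min ?_ (convex_setOf_pairing_le p _))
        (isClosed_setOf_pairing_le p _) hd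
      rintro _ (hv | ⟨g, hg, rfl⟩)
      · exact le_max_of_le_left
          (Finset.sum_nonpos fun k _ => mul_nonpos_of_nonneg_of_nonpos (hp.1 k) (hv k))
      · refine le_max_of_le_right (a := pairing p (g - l)) ?_
        rw [pairing_eq_dotProduct, dotProduct_sub]
        exact sub_le_sub_right (hG.pairing_le_suppFn hp hg) _
    rw [← hmax p hp] at hdp
    have hap := hL.pairing_le_suppFn hp ha
    have hadd : pairing p (a + d) = pairing p a + pairing p d := dotProduct_add p a d
    rcases le_max_iff.1 hdp with h | h <;> linarith
end
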